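/- Let m ≥ 1, let U > 0, let ψ : ℝ → ℝ^m be continuous, and let u : ℝ → ℝ^m be differentiable with ‖u(0)‖² = U and u'(t) = ψ(t) − (⟨u(t), ψ(t)⟩/U) • u(t) for all t ∈ ℝ. Then ‖u(t)‖² = U for all t ∈ ℝ; that is, solutions of the equation du = A(u) dΦ with A(u) = I − u u*/U remain on the sphere of squared radius U. -/

import Mathlib

open scoped RealInnerProductSpace

/-- A solution of the scalar linear equation `g' = a g` with continuous coefficient that
vanishes at `0` vanishes identically. -/
theorem eq_zero_of_hasDerivAt_mul_self {a g : ℝ → ℝ} (ha : Continuous a)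
    (hg : ∀ t, HasDerivAt g (a t * g t) t) (h0 : g 0 = 0) (t : ℝ) : g t = 0 := by
  have hderiv : ∀ t, HasDerivAt (fun t => g t * Real.exp (-∫ s in (0 : ℝ)..t, a s)) 0 t := by
    intro t
    have hint := (ha.integral_hasStrictDerivAt 0 t).hasDerivAt
    refine ((hg t).mul hint.neg.exp).congr_deriv ?_
    simp only [Pi.neg_apply]
    ring
  have hconst := is_const_of_deriv_eq_zero (fun t => (hderiv t).differentiableAt)
    (fun t => (hderiv t).deriv) t 0
  simpa [h0, Real.exp_ne_zero] using hconst

/-- Solutions of `du = A(u) dΦ` with `A(u) = I - u u*/U` (i.e. `u'(t) = ψ(t) -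
(⟪u(t), ψ(t)⟫/U) • u(t)` for a continuous driving signal `ψ`) remain on the sphere of
squared radius `U`. -/
theorem stays_on_sphere
    (m : ℕ) (hm : 1 ≤ m) (U : ℝ) (hU : 0 < U)
    (ψ : ℝ → EuclideanSpace ℝ (Fin m)) (hψ : Continuous ψ)
    (u : ℝ → EuclideanSpace ℝ (Fin m))
    (hu : ∀ t : ℝ, HasDerivAt u (ψ t - ((⟪u t, ψ t⟫) / U) • u t) t)
    (h0 : ‖u 0‖ ^ 2 = U) :
    ∀ t : ℝ, ‖u t‖ ^ 2 = U := by
  have hcont : Continuous u := continuous_iff_continuousAt.2 fun t => (hu t).continuousAt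
  have hcoeff : Continuous fun t => -(2 * ⟪u t, ψ t⟫ / U) :=
    ((continuous_const.mul (hcont.inner hψ)).div_const U).neg
  have hg : ∀ t, HasDerivAt (fun t => ‖u t‖ ^ 2 - U)
      (-(2 * ⟪u t, ψ t⟫ / U) * (‖u t‖ ^ 2 - U)) t := by
    intro t
    refine ((hu t).norm_sq.sub_const U).congr_deriv ?_
    rw [inner_sub_right, inner_smul_right, real_inner_self_eq_norm_sq]
    field_simp
    ring
  intro t
  exact sub_eq_zero.1 (eq_zero_of_hasDerivAt_mul_self hcoeff hg (sub_eq_zero.2 h0) t)
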